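/- Let p be a prime number and let R be a commutative ring of characteristic p. Let B ⊆ Ω¹_{R/ℤ} be the additive subgroup of exact forms, i.e. the image of the universal derivation d : R → Ω¹_{R/ℤ}. Then there exists a unique additive group homomorphism C⁻¹ : Ω¹_{R/ℤ} → Ω¹_{R/ℤ}/B such that for all r, s ∈ R one has C⁻¹(s·d r) = class of s^{p}·r^{p−1}·d r modulo B. -/

import Mathlib

set_option synthInstance.maxHeartbeats 1000000

namespace KaehlerDifferential

/-- The exact forms in `Ω¹_{R/ℤ}`. -/
noncomputable abbrev exactForms (R : Type*) [CommRing R] : Submodule ℤ (KaehlerDifferential ℤ R) :=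
  LinearMap.range (D ℤ R).toLinearMap

/-- `(x + y)^(p-1) d(x + y) - x^(p-1) dx - y^(p-1) dy` is exact when the differentials of the ring
have no `p`-torsion. -/
theorem exists_D_add_pow_sub_of_torsionFree (p : ℕ) (hp : p.Prime) {k A : Type*} [CommRing k]
    [CommRing A] [Algebra k A] [IsAddTorsionFree (KaehlerDifferential k A)] (x y : A) :
    ∃ r : A, D k A r + x ^ (p - 1) • D k A x + y ^ (p - 1) • D k A y =
      (x + y) ^ (p - 1) • D k A (x + y) := by
  obtain ⟨r, hr⟩ := exists_add_pow_prime_eq hp x y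
  rw [mul_assoc, mul_assoc, ← nsmul_eq_mul] at hr
  refine ⟨x * (y * r), nsmul_right_injective hp.ne_zero ?_⟩
  have h := congrArg (D k A) hr
  rw [map_add, map_add, map_nsmul, Derivation.leibniz_pow, Derivation.leibniz_pow,
    Derivation.leibniz_pow] at h
  simp only [smul_add] at h ⊢
  rw [h]
  abel

/-- `(x + y)^(p-1) d(x + y) - x^(p-1) dx - y^(p-1) dy` is always exact. -/
theorem exists_D_add_pow_sub (p : ℕ) (hp : p.Prime) {R : Type*} [CommRing R] (x y : R) :
    ∃ r : R, D ℤ R r + x ^ (p - 1) • D ℤ R x + y ^ (p - 1) • D ℤ R y =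
      (x + y) ^ (p - 1) • D ℤ R (x + y) := by
  let : Algebra (MvPolynomial (Fin 2) ℤ) R :=
    (MvPolynomial.aeval ![x, y] : MvPolynomial (Fin 2) ℤ →ₐ[ℤ] R).toRingHom.toAlgebra
  have : IsAddTorsionFree (KaehlerDifferential ℤ (MvPolynomial (Fin 2) ℤ)) :=
    (mvPolynomialBasis ℤ (Fin 2)).repr.injective.isAddTorsionFree
      (mvPolynomialBasis ℤ (Fin 2)).repr.toLinearMap.toAddMonoidHom
  have hx : algebraMap (MvPolynomial (Fin 2) ℤ) R (MvPolynomial.X 0) = x := by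
    exact MvPolynomial.aeval_X ![x, y] 0
  have hy : algebraMap (MvPolynomial (Fin 2) ℤ) R (MvPolynomial.X 1) = y := by
    exact MvPolynomial.aeval_X ![x, y] 1
  obtain ⟨r, hr⟩ := exists_D_add_pow_sub_of_torsionFree (k := ℤ) p hp
    (MvPolynomial.X 0 : MvPolynomial (Fin 2) ℤ) (MvPolynomial.X 1)
  refine ⟨algebraMap (MvPolynomial (Fin 2) ℤ) R r, ?_⟩
  have h := congrArg (KaehlerDifferential.map ℤ ℤ (MvPolynomial (Fin 2) ℤ) R) hr
  simp only [map_add, map_smul, map_D, hx, hy] at h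
  simp only [algebra_compatible_smul R (_ : MvPolynomial (Fin 2) ℤ), map_pow, map_add, hx, hy] at h
  simpa only [map_add] using h

variable (p : ℕ) {R : Type*} [CommRing R] [CharP R p]

/-- `p`-th powers are constants for the universal derivation in characteristic `p`. -/
theorem D_pow_char_mul (s r : R) : D ℤ R (s ^ p * r) = s ^ p • D ℤ R r := by
  have h : D ℤ R (s ^ p) = 0 := by
    rw [Derivation.leibniz_pow, ← Nat.cast_smul_eq_nsmul R, CharP.cast_eq_zero, zero_smul]
  rw [Derivation.leibniz, h, smul_zero, add_zero]

/-- Multiplication by `s ^ p` on differential forms modulo exact forms. -/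
noncomputable def powSMulQuotient (s : R) :
    (KaehlerDifferential ℤ R ⧸ exactForms R) →ₗ[ℤ] (KaehlerDifferential ℤ R ⧸ exactForms R) :=
  (exactForms R).mapQ (exactForms R)
    (DistribSMul.toAddMonoidHom (KaehlerDifferential ℤ R) (s ^ p)).toIntLinearMap (by
      rintro _ ⟨r, rfl⟩
      exact ⟨s ^ p * r, D_pow_char_mul p s r⟩)

theorem powSMulQuotient_mk (s : R) (w : KaehlerDifferential ℤ R) :
    powSMulQuotient p s (Submodule.Quotient.mk w) = Submodule.Quotient.mk (s ^ p • w) :=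
  rfl

/-- Differential forms modulo exact forms, as an `R`-module through the Frobenius. -/
noncomputable abbrev frobeniusModule (hp : p.Prime) :
    Module R (KaehlerDifferential ℤ R ⧸ exactForms R) where
  smul s q := powSMulQuotient p s q
  one_smul q := by
    obtain ⟨w, rfl⟩ := Submodule.Quotient.mk_surjective _ q
    change powSMulQuotient p _ _ = _
    rw [powSMulQuotient_mk, one_pow, one_smul]
  mul_smul s t q := by
    obtain ⟨w, rfl⟩ := Submodule.Quotient.mk_surjective _ q
    change powSMulQuotient p _ _ = powSMulQuotient p _ (powSMulQuotient p _ _)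
    rw [powSMulQuotient_mk, powSMulQuotient_mk, powSMulQuotient_mk, mul_pow, mul_smul]
  smul_zero s := map_zero (powSMulQuotient p s)
  smul_add s := map_add (powSMulQuotient p s)
  add_smul s t q := by
    have := Fact.mk hp
    obtain ⟨w, rfl⟩ := Submodule.Quotient.mk_surjective _ q
    change powSMulQuotient p _ _ = powSMulQuotient p _ _ + powSMulQuotient p _ _
    rw [powSMulQuotient_mk, powSMulQuotient_mk, powSMulQuotient_mk, add_pow_char, add_smul,
      Submodule.Quotient.mk_add]
  zero_smul q := by
    obtain ⟨w, rfl⟩ := Submodule.Quotient.mk_surjective _ q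
    change powSMulQuotient p _ _ = _
    rw [powSMulQuotient_mk, zero_pow hp.ne_zero, zero_smul, Submodule.Quotient.mk_zero]

/-- The additive map `r ↦ [r^(p-1) dr]`. -/
noncomputable def powD (hp : p.Prime) (R : Type*) [CommRing R] :
    R →+ KaehlerDifferential ℤ R ⧸ exactForms R :=
  AddMonoidHom.mk' (fun r => Submodule.Quotient.mk (r ^ (p - 1) • D ℤ R r)) fun x y => by
    obtain ⟨r, hr⟩ := exists_D_add_pow_sub p hp x y
    rw [← Submodule.Quotient.mk_add, Submodule.Quotient.eq]
    exact ⟨r, by rw [← hr, add_assoc, add_sub_cancel_right]; rfl⟩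

theorem powD_apply (p : ℕ) (hp : p.Prime) {R : Type*} [CommRing R] (r : R) :
    powD p hp R r = Submodule.Quotient.mk (r ^ (p - 1) • D ℤ R r) :=
  rfl

theorem powD_mul (hp : p.Prime) (x y : R) :
    powD p hp R (x * y) =
      powSMulQuotient p x (powD p hp R y) + powSMulQuotient p y (powD p hp R x) := by
  simp only [powD_apply, powSMulQuotient_mk, ← Submodule.Quotient.mk_add]
  congr 1
  obtain ⟨n, rfl⟩ : ∃ n, p = n + 1 := ⟨p - 1, (Nat.succ_pred hp.ne_zero).symm⟩
  rw [Derivation.leibniz]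
  simp only [smul_add, smul_smul, Nat.add_sub_cancel]
  congr 2 <;> ring

/-- The inverse Cartier operator. -/
noncomputable def inverseCartier (hp : p.Prime) :
    KaehlerDifferential ℤ R →+ KaehlerDifferential ℤ R ⧸ exactForms R :=
  letI := frobeniusModule p (R := R) hp
  (Derivation.mk' (powD p hp R).toIntLinearMap
    (powD_mul p hp)).liftKaehlerDifferential.toAddMonoidHom

theorem inverseCartier_smul_D (hp : p.Prime) (r s : R) :
    inverseCartier p hp (s • D ℤ R r) =
      Submodule.Quotient.mk ((s ^ p * r ^ (p - 1)) • D ℤ R r) := by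
  let := frobeniusModule p (R := R) hp
  change (Derivation.mk' (powD p hp R).toIntLinearMap
    (powD_mul p hp)).liftKaehlerDifferential (s • D ℤ R r) = _
  rw [map_smul, Derivation.liftKaehlerDifferential_comp_D, mul_smul]
  rfl

/-- Additive maps out of `Ω¹_{R/ℤ}` are determined by their values on the forms `s dr`. -/
theorem addMonoidHom_ext {R M : Type*} [CommRing R] [AddCommGroup M]
    {f g : KaehlerDifferential ℤ R →+ M}
    (h : ∀ r s : R, f (s • D ℤ R r) = g (s • D ℤ R r)) : f = g := by
  ext w
  have hw : w ∈ Submodule.span R (Set.range (D ℤ R)) := by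
    rw [span_range_derivation]
    exact Submodule.mem_top
  obtain ⟨c, rfl⟩ := (Finsupp.mem_span_range_iff_exists_finsupp).1 hw
  simp only [Finsupp.sum, map_sum, h]

end KaehlerDifferential

/-- Let `p` be prime and `R` a commutative ring of characteristic `p`, and
let `B ⊆ Ω¹_{R/ℤ}` be the subgroup of exact forms, i.e. the image of the universal derivation
`d : R → Ω¹_{R/ℤ}`. Then there is a unique additive group homomorphism
`C⁻¹ : Ω¹_{R/ℤ} → Ω¹_{R/ℤ}/B` (the inverse Cartier operator) with
`C⁻¹(s·dr) = [s^p·r^{p−1}·dr]` for all `r, s ∈ R`. -/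
theorem inverse_cartier_exists_unique (p : ℕ) (hp : p.Prime) (R : Type*) [CommRing R]
    [CharP R p] :
    ∃! F : KaehlerDifferential ℤ R →+
        (KaehlerDifferential ℤ R ⧸ LinearMap.range (KaehlerDifferential.D ℤ R).toLinearMap),
      ∀ r s : R,
        F (s • (KaehlerDifferential.D ℤ R) r) =
          Submodule.Quotient.mk ((s ^ p * r ^ (p - 1)) • (KaehlerDifferential.D ℤ R) r) := by
  exact ⟨KaehlerDifferential.inverseCartier p hp,
    KaehlerDifferential.inverseCartier_smul_D p hp,
    fun G hG => KaehlerDifferential.addMonoidHom_ext fun r s =>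
      (hG r s).trans (KaehlerDifferential.inverseCartier_smul_D p hp r s).symm⟩
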